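/- For the bubble-diagram polynomial f(x₁,x₂; m₀,m₁,m₂) = (1 − m₁x₁ − m₂x₂)(x₁ + x₂) + m₀x₁x₂, and generic complex (m₀,m₁,m₂) with m₀m₁m₂ ≠ 0 and Δ₂(m₀,m₁,m₂) ≠ 0, the system of critical point equations of the log-likelihood ν₀·log f + ν₁·log x₁ + ν₂·log x₂ on the complement of {f = 0, x₁ = 0, x₂ = 0} in (ℂ*)², namely ν₁ = ν₀·x₁·(∂f/∂x₁)/f and ν₂ = ν₀·x₂·(∂f/∂x₂)/f, has exactly 3 solutions (x₁,x₂) ∈ (ℂ*)² with f(x₁,x₂) ≠ 0, for generic (ν₀,ν₁,ν₂). -/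

import Mathlib

/-- The dehomogenization `q(s)` of the quadratic part of `-f` along the line `x₂ = s * x₁`. -/
def bubbleQuadratic {R : Type*} [CommRing R] (m0 m1 m2 s : R) : R :=
  m1 + (m1 + m2 - m0) * s + m2 * s ^ 2

/-- The cubic in the ratio `s = x₂ / x₁` that eliminates `x₁` from the likelihood equations. -/
def likelihoodCubic {R : Type*} [CommRing R] (m0 m1 m2 ν0 ν1 ν2 : R) : Cubic R where
  a := -(ν1 * m2)
  b := ν2 * m2 - ν1 * (m1 + m2 - m0) + (ν1 + ν2 - ν0) * (m1 - m2 - m0)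
  c := ν2 * (m1 + m2 - m0) - ν1 * m1 + (ν1 + ν2 - ν0) * (m1 - m2 + m0)
  d := ν2 * m1

lemma map_likelihoodCubic_discr {R S : Type*} [CommRing R] [CommRing S] (φ : R →+* S)
    (m0 m1 m2 ν0 ν1 ν2 : R) :
    φ (likelihoodCubic m0 m1 m2 ν0 ν1 ν2).discr =
      (likelihoodCubic (φ m0) (φ m1) (φ m2) (φ ν0) (φ ν1) (φ ν2)).discr := by
  simp only [likelihoodCubic, Cubic.discr, map_add, map_sub, map_mul, map_neg, map_pow, map_ofNat]

lemma eval_likelihoodCubic {R : Type*} [CommRing R] (m0 m1 m2 ν0 ν1 ν2 s : R) :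
    (likelihoodCubic m0 m1 m2 ν0 ν1 ν2).toPoly.eval s =
      ν2 * (1 + s) * bubbleQuadratic m0 m1 m2 s
        + (ν1 + ν2 - 2 * ν0) * s * bubbleQuadratic m0 m1 m2 s
        - (ν1 + ν2 - ν0) * s * (1 + s) * (m1 + m2 - m0 + 2 * m2 * s) := by
  simp only [likelihoodCubic, bubbleQuadratic, Cubic.toPoly, Polynomial.eval_add,
    Polynomial.eval_mul, Polynomial.eval_C, Polynomial.eval_pow, Polynomial.eval_X]
  ring

/-- At a root of the likelihood cubic none of the excluded loci is met. -/
lemma root_likelihoodCubic_ne_zero {m0 m1 m2 ν0 ν1 ν2 s : ℂ} (hm : m0 * m1 * m2 ≠ 0)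
    (hΔ : m0 ^ 2 + m1 ^ 2 + m2 ^ 2 - 2 * m0 * m1 - 2 * m1 * m2 - 2 * m2 * m0 ≠ 0)
    (h2 : ν2 ≠ 0) (hN : ν1 + ν2 - ν0 ≠ 0) (hM : ν1 + ν2 - 2 * ν0 ≠ 0)
    (hs : (likelihoodCubic m0 m1 m2 ν0 ν1 ν2).toPoly.eval s = 0) :
    s ≠ 0 ∧ 1 + s ≠ 0 ∧ bubbleQuadratic m0 m1 m2 s ≠ 0 := by
  rw [eval_likelihoodCubic] at hs
  obtain ⟨⟨hm0, hm1⟩, hm2⟩ : (m0 ≠ 0 ∧ m1 ≠ 0) ∧ m2 ≠ 0 := by simpa [mul_ne_zero_iff] using hm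
  have hs0 : s ≠ 0 := by
    rintro rfl
    simp [bubbleQuadratic, h2, hm1] at hs
  have hs1 : 1 + s ≠ 0 := by
    intro h
    obtain rfl : s = -1 := by linear_combination h
    have : (ν1 + ν2 - 2 * ν0) * m0 = 0 := by
      simp only [bubbleQuadratic] at hs
      linear_combination -hs
    simp_all
  refine ⟨hs0, hs1, fun hq => ?_⟩
  rw [hq] at hs
  have hq' : m1 + m2 - m0 + 2 * m2 * s = 0 := by simpa [hN, hs0, hs1] using hs
  apply hΔ
  simp only [bubbleQuadratic] at hq
  linear_combination (m1 + m2 - m0 + 2 * m2 * s) * hq' - 4 * m2 * hq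

/-- The critical points of the likelihood function are parametrized by the roots of the
likelihood cubic. -/
lemma likelihood_equations_iff {m0 m1 m2 ν0 ν1 ν2 : ℂ} (hm : m0 * m1 * m2 ≠ 0)
    (hΔ : m0 ^ 2 + m1 ^ 2 + m2 ^ 2 - 2 * m0 * m1 - 2 * m1 * m2 - 2 * m2 * m0 ≠ 0)
    (h0 : ν0 ≠ 0) (h2 : ν2 ≠ 0) (hN : ν1 + ν2 - ν0 ≠ 0) (hM : ν1 + ν2 - 2 * ν0 ≠ 0)
    (x y : ℂ) :
    (x ≠ 0 ∧ y ≠ 0 ∧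
      (1 - m1 * x - m2 * y) * (x + y) + m0 * x * y ≠ 0 ∧
      ν1 * ((1 - m1 * x - m2 * y) * (x + y) + m0 * x * y) =
        ν0 * x * ((1 - m1 * x - m2 * y) - m1 * (x + y) + m0 * y) ∧
      ν2 * ((1 - m1 * x - m2 * y) * (x + y) + m0 * x * y) =
        ν0 * y * ((1 - m1 * x - m2 * y) - m2 * (x + y) + m0 * x)) ↔
    ∃ s, (likelihoodCubic m0 m1 m2 ν0 ν1 ν2).toPoly.eval s = 0 ∧
      x = (ν1 + ν2 - ν0) * (1 + s) / ((ν1 + ν2 - 2 * ν0) * bubbleQuadratic m0 m1 m2 s) ∧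
      y = s * x := by
  constructor
  · rintro ⟨hx, hy, hf, e1, e2⟩
    obtain ⟨s, rfl⟩ : ∃ s, y = s * x := ⟨y / x, by field_simp⟩
    set q := bubbleQuadratic m0 m1 m2 s with hq
    have hqdef : q = m1 + (m1 + m2 - m0) * s + m2 * s ^ 2 := rfl
    have euler : (ν1 + ν2 - 2 * ν0) * q * x = (ν1 + ν2 - ν0) * (1 + s) := by
      apply mul_left_cancel₀ hx
      rw [hqdef]
      linear_combination -e1 - e2
    have hfac : (1 - m1 * x - m2 * (s * x)) * (x + s * x) + m0 * x * (s * x)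
        = x * (1 + s - x * q) := by rw [hqdef]; ring
    have hq0 : q ≠ 0 := by
      intro h
      rw [h] at euler hfac
      have : 1 + s = 0 := by simpa [hN] using euler.symm
      apply hf
      rw [hfac, this]
      ring
    have hx' : x = (ν1 + ν2 - ν0) * (1 + s) / ((ν1 + ν2 - 2 * ν0) * q) := by
      rw [eq_div_iff (mul_ne_zero hM hq0)]
      linear_combination euler
    refine ⟨s, ?_, hx', rfl⟩
    rw [eval_likelihoodCubic, ← hq]
    apply mul_left_cancel₀ (mul_ne_zero h0 hx)
    have e2' : x * (ν2 * (1 + s - x * q)) =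
        x * (ν0 * s * (1 - x * (m1 + m2 - m0 + 2 * m2 * s))) := by
      rw [hqdef]
      linear_combination e2
    have e3 := mul_left_cancel₀ hx e2'
    linear_combination (-(ν1 + ν2 - 2 * ν0) * q * x) * e3
      + (-x) * (ν2 * q - ν0 * s * (m1 + m2 - m0 + 2 * m2 * s)) * euler
  · rintro ⟨s, hs, hx, rfl⟩
    obtain ⟨hs0, hs1, hq0⟩ := root_likelihoodCubic_ne_zero hm hΔ h2 hN hM hs
    rw [eval_likelihoodCubic] at hs
    set q := bubbleQuadratic m0 m1 m2 s with hq
    have hqdef : q = m1 + (m1 + m2 - m0) * s + m2 * s ^ 2 := rfl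
    have hx0 : x ≠ 0 := by
      rw [hx]
      exact div_ne_zero (mul_ne_zero hN hs1) (mul_ne_zero hM hq0)
    have euler : (ν1 + ν2 - 2 * ν0) * q * x = (ν1 + ν2 - ν0) * (1 + s) := by
      rw [hx]
      field_simp
    have hfac : (ν1 + ν2 - 2 * ν0) *
        ((1 - m1 * x - m2 * (s * x)) * (x + s * x) + m0 * x * (s * x)) = -(ν0 * x * (1 + s)) := by
      rw [hqdef] at euler
      linear_combination -x * euler
    have e2 : ν2 * ((1 - m1 * x - m2 * (s * x)) * (x + s * x) + m0 * x * (s * x)) =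
        ν0 * (s * x) * ((1 - m1 * x - m2 * (s * x)) - m2 * (x + s * x) + m0 * x) := by
      apply mul_left_cancel₀ (mul_ne_zero hM hq0)
      linear_combination q * ν2 * hfac - ν0 * x * hs +
        ν0 * s * x * (m1 + m2 - m0 + 2 * m2 * s) * euler
    refine ⟨hx0, mul_ne_zero hs0 hx0, fun h => ?_, ?_, e2⟩
    · rw [h] at hfac
      simp [h0, hx0, hs1] at hfac
    · rw [hqdef] at euler
      linear_combination -x * euler - e2

lemma card_roots_likelihoodCubic {m0 m1 m2 ν0 ν1 ν2 : ℂ} (hm2 : m2 ≠ 0) (h1 : ν1 ≠ 0)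
    (hd : (likelihoodCubic m0 m1 m2 ν0 ν1 ν2).discr ≠ 0) :
    {s : ℂ | (likelihoodCubic m0 m1 m2 ν0 ν1 ν2).toPoly.eval s = 0}.ncard = 3 := by
  classical
  have ha : (likelihoodCubic m0 m1 m2 ν0 ν1 ν2).a ≠ 0 := neg_ne_zero.mpr (mul_ne_zero h1 hm2)
  rw [← Cubic.card_roots_of_discr_ne_zero (φ := RingHom.id ℂ) ha (IsAlgClosed.splits _) hd,
    ← Set.ncard_coe_finset]
  congr 1
  ext s
  simp [Cubic.map_roots, Cubic.ne_zero_of_a_ne_zero ha]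

/-- **Maximum likelihood degree of the bubble diagram.**
For `f(x₁,x₂) = (1 − m₁x₁ − m₂x₂)(x₁+x₂) + m₀x₁x₂` with `m₀m₁m₂ ≠ 0` and
`Δ₂(m₀,m₁,m₂) ≠ 0`, the likelihood equations `ν₁·f = ν₀·x₁·∂f/∂x₁` and
`ν₂·f = ν₀·x₂·∂f/∂x₂` have exactly `3` solutions `(x₁,x₂) ∈ (ℂ*)²` with `f ≠ 0`,
for all `(ν₀,ν₁,ν₂)` outside the zero set of some nonzero polynomial (genericity). -/
theorem stmt_19 (m0 m1 m2 : ℂ) (hm : m0 * m1 * m2 ≠ 0)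
    (hΔ : m0 ^ 2 + m1 ^ 2 + m2 ^ 2 - 2 * m0 * m1 - 2 * m1 * m2 - 2 * m2 * m0 ≠ 0) :
    ∃ g : MvPolynomial (Fin 3) ℂ, g ≠ 0 ∧
      ∀ ν0 ν1 ν2 : ℂ, MvPolynomial.eval ![ν0, ν1, ν2] g ≠ 0 →
        Set.ncard {x : ℂ × ℂ |
          x.1 ≠ 0 ∧ x.2 ≠ 0 ∧
          (1 - m1 * x.1 - m2 * x.2) * (x.1 + x.2) + m0 * x.1 * x.2 ≠ 0 ∧
          ν1 * ((1 - m1 * x.1 - m2 * x.2) * (x.1 + x.2) + m0 * x.1 * x.2) =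
            ν0 * x.1 * ((1 - m1 * x.1 - m2 * x.2) - m1 * (x.1 + x.2) + m0 * x.2) ∧
          ν2 * ((1 - m1 * x.1 - m2 * x.2) * (x.1 + x.2) + m0 * x.1 * x.2) =
            ν0 * x.2 * ((1 - m1 * x.1 - m2 * x.2) - m2 * (x.1 + x.2) + m0 * x.1)}
          = 3 := by
  obtain ⟨⟨-, hm1⟩, hm2⟩ : (m0 ≠ 0 ∧ m1 ≠ 0) ∧ m2 ≠ 0 := by simpa [mul_ne_zero_iff] using hm
  let N : MvPolynomial (Fin 3) ℂ := .X 1 + .X 2 - .X 0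
  let M : MvPolynomial (Fin 3) ℂ := .X 1 + .X 2 - 2 * .X 0
  let D : MvPolynomial (Fin 3) ℂ :=
    (likelihoodCubic (.C m0) (.C m1) (.C m2) (.X 0) (.X 1) (.X 2)).discr
  have hD (ν0 ν1 ν2 : ℂ) : MvPolynomial.eval ![ν0, ν1, ν2] D =
      (likelihoodCubic m0 m1 m2 ν0 ν1 ν2).discr := by
    simp [D, map_likelihoodCubic_discr]
  have hN0 : N ≠ 0 := fun h => by
    simpa [N] using congrArg (MvPolynomial.eval ![1, 0, 0]) h
  have hM0 : M ≠ 0 := fun h => by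
    simpa [M] using congrArg (MvPolynomial.eval ![1, 0, 0]) h
  have hD0 : D ≠ 0 := fun h => by
    have := congrArg (MvPolynomial.eval ![1, 1, 0]) h
    rw [hD, map_zero] at this
    refine mul_ne_zero (pow_ne_zero 2 hm1) hΔ ?_
    simp only [likelihoodCubic, Cubic.discr] at this
    linear_combination this
  refine ⟨.X 0 * .X 1 * .X 2 * N * M * D, by simp [hN0, hM0, hD0], fun ν0 ν1 ν2 hg => ?_⟩
  simp only [map_mul, hD, mul_ne_zero_iff] at hg
  obtain ⟨⟨⟨⟨⟨h0, h1⟩, h2⟩, hN⟩, hM⟩, hd⟩ := hg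
  replace h0 : ν0 ≠ 0 := by simpa using h0
  replace h1 : ν1 ≠ 0 := by simpa using h1
  replace h2 : ν2 ≠ 0 := by simpa using h2
  replace hN : ν1 + ν2 - ν0 ≠ 0 := by simpa [N] using hN
  replace hM : ν1 + ν2 - 2 * ν0 ≠ 0 := by simpa [M] using hM
  simp only [likelihood_equations_iff hm hΔ h0 h2 hN hM]
  let X (s : ℂ) : ℂ :=
    (ν1 + ν2 - ν0) * (1 + s) / ((ν1 + ν2 - 2 * ν0) * bubbleQuadratic m0 m1 m2 s)
  rw [← card_roots_likelihoodCubic hm2 h1 hd,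
    ← Set.InjOn.ncard_image (f := fun s => (X s, s * X s))]
  · congr 1
    ext ⟨x, y⟩
    simp only [Set.mem_ofPred_eq, Set.mem_image, Prod.mk.injEq]
    refine exists_congr fun s => and_congr_right fun _ => ?_
    constructor <;> rintro ⟨rfl, rfl⟩ <;> exact ⟨rfl, rfl⟩
  · intro s hs t _ hst
    obtain ⟨-, hs1, hq0⟩ := root_likelihoodCubic_ne_zero hm hΔ h2 hN hM hs
    obtain ⟨hX, hsX⟩ := Prod.mk.inj hst
    have hX0 : X s ≠ 0 := div_ne_zero (mul_ne_zero hN hs1) (mul_ne_zero hM hq0)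
    exact mul_right_cancel₀ hX0 (hsX.trans (by rw [hX]))
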